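/- arXiv:2105.03284 — 2 statements merged into one kernel-verified Lean document; each statement's English description precedes it below -/
import Mathlib

section
/- Fix an integer g ≥ 0. Then the cardinality of 𝔽ₙᵍ satisfies |𝔽ₙᵍ| ∼ n^{n−2+5g} / (24^g · g!) as n → ∞; that is, the ratio |𝔽ₙᵍ| · 24^g · g! / n^{n−2+5g} tends to 1. -/
open Filter

/-- Left-to-right product of a list of permutations: the leftmost entry is applied first. -/
def prodLR {n : ℕ} (l : List (Equiv.Perm (Fin n))) : Equiv.Perm (Fin n) :=
  l.reverse.prod

/-- The set `𝔽ₙᵍ` of genus-`g` factorizations of the `n`-cycle `(1 2 ⋯ n)`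
into transpositions. -/
def Fcal (n g : ℕ) : Set (List (Equiv.Perm (Fin n))) :=
  {l | l.length = n - 1 + 2 * g ∧ (∀ t ∈ l, t.IsSwap) ∧ prodLR l = finRotate n}

open Polynomial Matrix in
/-- `det (1 + X P_σ)`. -/
noncomputable def fpol {n : ℕ} (s : Equiv.Perm (Fin n)) : ℝ[X] :=
  det (1 + (X : ℝ[X]) • (s.permMatrix ℝ).map C)

open Polynomial Matrix in
lemma eval_gen {n : ℕ} (A : Matrix (Fin n) (Fin n) ℝ) (x : ℝ) :
    eval x (det (1 + (X : ℝ[X]) • A.map C)) = det (1 + x • A) := by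
  rw [← coe_evalRingHom, RingHom.map_det]
  congr 1
  ext i j
  by_cases h : i = j <;> simp [h] <;> ring

open Polynomial Matrix in
lemma deriv_gen {n : ℕ} (A : Matrix (Fin n) (Fin n) ℝ) (x : ℝ) (hx : det (1 + x • A) ≠ 0) :
    eval x (derivative (det (1 + (X : ℝ[X]) • A.map C)))
      = det (1 + x • A) * trace ((1 + x • A)⁻¹ * A) := by
  set M := 1 + x • A with hM
  have hu : IsUnit M.det := isUnit_iff_ne_zero.mpr hx
  have key : (det (1 + (X : ℝ[X]) • A.map C)).comp (X + C x)
      = C (det M) * det (1 + (X : ℝ[X]) • (M⁻¹ * A).map C) := by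
    apply Polynomial.funext
    intro y
    rw [eval_comp, eval_gen, eval_mul, eval_gen, eval_C, ← det_mul]
    congr 1
    rw [Matrix.mul_add, Matrix.mul_one, Matrix.mul_smul, ← Matrix.mul_assoc, Matrix.mul_nonsing_inv _ hu,
      Matrix.one_mul, hM]
    simp [add_smul]
    abel
  have h2 := congrArg (fun p => eval 0 (derivative p)) key
  simp only [derivative_comp, derivative_C_mul, eval_mul, eval_C, derivative_det_one_add_X_smul] at h2
  simpa [eval_comp] using h2

open Matrix in
lemma det_swap {n : ℕ} (A : Matrix (Fin n) (Fin n) ℝ) (x : ℝ) (hx : det (1 + x • A) ≠ 0)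
    (i j : Fin n) :
    det (1 + x • ((Equiv.swap i j).permMatrix ℝ * A)) = det (1 + x • A) *
      (1 - x * ((A * (1 + x • A)⁻¹) i i + (A * (1 + x • A)⁻¹) j j - (A * (1 + x • A)⁻¹) i j
        - (A * (1 + x • A)⁻¹) j i)) := by
  set M := 1 + x • A with hM
  have hu : IsUnit M.det := isUnit_iff_ne_zero.mpr hx
  set B := A * M⁻¹ with hB
  let v : Fin n → ℝ := Pi.single i 1 - Pi.single j 1
  have hP : (Equiv.swap i j).permMatrix ℝ = 1 - vecMulVec v v := by
    ext a b
    simp only [Equiv.Perm.permMatrix, PEquiv.toMatrix_apply, Equiv.toPEquiv_apply, Option.mem_def, Matrix.sub_apply,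
      vecMulVec_apply, v, Pi.sub_apply, Matrix.one_apply, Pi.single_apply, Option.some.injEq, Equiv.swap_apply_def]
    by_cases hij : i = j
    · subst hij
      by_cases h1 : a = i <;> by_cases h2 : b = a <;> simp [h1, h2, eq_comm]
    · split_ifs <;> first | (exfalso; subst_vars; first | contradiction | (apply_assumption; rfl)) | norm_num
  have hBM : B * M = A := by rw [hB, Matrix.mul_assoc, Matrix.nonsing_inv_mul _ hu, Matrix.mul_one]
  have e : 1 + x • ((Equiv.swap i j).permMatrix ℝ * A)
      = (1 + replicateCol Unit (-x • v) * replicateRow Unit (v ᵥ* B)) * M := by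
    rw [hP, Matrix.add_mul, Matrix.one_mul, Matrix.sub_mul, Matrix.one_mul, ← vecMulVec_eq, Matrix.smul_vecMulVec, ← vecMulVec_mul,
     Matrix.smul_mul, Matrix.mul_assoc, hBM, hM, smul_sub]
    simp [sub_eq_add_neg, add_assoc]
  rw [e, det_mul, det_one_add_replicateCol_mul_replicateRow, mul_comm]
  congr 1
  simp [v, sub_vecMul]
  ring

/-- The finset of swaps. -/
noncomputable def swaps (n : ℕ) : Finset (Equiv.Perm (Fin n)) := by
  classical exact Finset.univ.filter (fun t => t.IsSwap)

lemma mem_swaps {n : ℕ} (t : Equiv.Perm (Fin n)) : t ∈ swaps n ↔ t.IsSwap := by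
  simp [swaps]

lemma sum_swaps {n : ℕ} (F : Equiv.Perm (Fin n) → ℝ) :
    2 * ∑ t ∈ swaps n, F t = (∑ i, ∑ j, F (Equiv.swap i j)) - n * F 1 := by
  have h1 : ∑ t ∈ swaps n, F t
      = ∑ p ∈ (Finset.univ : Finset (Fin n × Fin n)).filter (fun p => p.1 < p.2),
        F (Equiv.swap p.1 p.2) := by
    symm
    apply Finset.sum_nbij (fun p => Equiv.swap p.1 p.2)
    · rintro ⟨i, j⟩ h
      simp only [Finset.mem_filter, Finset.mem_univ, true_and] at h
      rw [mem_swaps]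
      exact ⟨i, j, h.ne, rfl⟩
    · rintro ⟨i, j⟩ h ⟨k, l⟩ h' he
      simp only [Finset.coe_filter, Finset.mem_univ, true_and, Set.mem_ofPred_eq] at h h'
      simp only at he
      have e1 := congrArg (fun s => s i) he
      have e2 := congrArg (fun s => s j) he
      simp only [Equiv.swap_apply_left, Equiv.swap_apply_right] at e1 e2
      simp only [Equiv.swap_apply_def] at e1 e2
      simp only [Prod.mk.injEq]
      split_ifs at e1 e2 <;> grind
    · intro t ht
      rw [Finset.mem_coe, mem_swaps] at ht
      obtain ⟨i, j, hij, rfl⟩ := ht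
      rcases lt_or_gt_of_ne hij with h | h
      · exact ⟨(i, j), by simpa using h, rfl⟩
      · exact ⟨(j, i), by simpa using h, Equiv.swap_comm _ _⟩
    · intro p _; rfl
  have h2 : ∑ p ∈ (Finset.univ : Finset (Fin n × Fin n)).filter (fun p => p.1 < p.2),
        F (Equiv.swap p.1 p.2) = ∑ i, ∑ j, if i < j then F (Equiv.swap i j) else 0 := by
    rw [Finset.sum_filter, Fintype.sum_prod_type]
  have h3 : ∑ i : Fin n, ∑ j, (if i < j then F (Equiv.swap i j) else 0)
      = ∑ i : Fin n, ∑ j, (if j < i then F (Equiv.swap i j) else 0) := by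
    rw [Finset.sum_comm]
    simp_rw [Equiv.swap_comm]
  have h4 : (n : ℝ) * F 1 = ∑ i : Fin n, ∑ j, (if i = j then F (Equiv.swap i j) else 0) := by
    simp [Finset.sum_ite_eq, ← Equiv.Perm.one_def]
  rw [two_mul]
  nth_rewrite 2 [h1]
  rw [h1, h2]
  nth_rewrite 2 [h3]
  rw [h4, ← Finset.sum_add_distrib, ← Finset.sum_sub_distrib]
  refine Finset.sum_congr rfl fun i _ => ?_
  rw [← Finset.sum_add_distrib, ← Finset.sum_sub_distrib]
  refine Finset.sum_congr rfl fun j _ => ?_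
  rcases lt_trichotomy i j with h | h | h
  · simp [h, h.ne, h.not_gt]
  · simp [h]
  · simp [h, h.ne', h.not_gt]

open Matrix Polynomial in
lemma key_eval {n : ℕ} (s : Equiv.Perm (Fin n)) (x : ℝ) (hx : eval x (fpol s) ≠ 0) (hx1 : 1 + x ≠ 0) :
    (1 + x) * ∑ t ∈ swaps n, eval x (fpol (s * t))
     = (1 + x) * (((n : ℝ) * (n - 1) / 2) * eval x (fpol s) - n * x * eval x (derivative (fpol s)))
      + n * x * eval x (fpol s) := by
  have h0 := sum_swaps (fun t => eval x (fpol (s * t)))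
  simp only [fpol, eval_gen, permMatrix_mul, permMatrix_one, Matrix.one_mul] at h0 hx ⊢
  rw [deriv_gen _ _ hx]
  set A := s.permMatrix ℝ with hA
  simp only [det_swap A x hx] at h0
  rw [Matrix.trace_mul_comm]
  set M := 1 + x • A with hM
  have hu : IsUnit M.det := isUnit_iff_ne_zero.mpr hx
  set B := A * M⁻¹ with hB
  have hA1 : A *ᵥ 1 = 1 := by rw [hA, permMatrix_mulVec]; rfl
  have hM1 : M *ᵥ 1 = (1 + x) • 1 := by
    rw [hM, add_mulVec, smul_mulVec, hA1, one_mulVec, add_smul, one_smul]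
  have hB1 : (1 + x) • (B *ᵥ 1) = 1 := by
    rw [← mulVec_smul, ← hM1, mulVec_mulVec, hB, Matrix.mul_assoc, Matrix.nonsing_inv_mul _ hu,
      Matrix.mul_one, hA1]
  have hr : ∀ i, (1 + x) * ∑ j, B i j = 1 := by
    intro i
    have := congrFun hB1 i
    simpa [mulVec, dotProduct] using this
  have hS : (1 + x) * ∑ i, ∑ j, B i j = n := by
    rw [Finset.mul_sum]; simp [hr]
  have hS' : ∑ i, ∑ j, B j i = ∑ i, ∑ j, B i j := Finset.sum_comm
  simp only [← Finset.mul_sum, Finset.sum_sub_distrib, Finset.sum_add_distrib, Finset.sum_const,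
    Finset.card_univ, Fintype.card_fin, nsmul_eq_mul, hS', mul_one] at h0
  have ht : trace B = ∑ i, B i i := rfl
  rw [← ht] at h0
  generalize (∑ i, ∑ j, B i j) = S at *
  linear_combination (1 + x) / 2 * h0 + x * M.det * hS

open Matrix Polynomial in
lemma key_poly {n : ℕ} (s : Equiv.Perm (Fin n)) :
    (1 + X) * ∑ t ∈ swaps n, fpol (s * t)
     = (1 + X) * (C ((n : ℝ) * (n - 1) / 2) * fpol s - C (n : ℝ) * X * derivative (fpol s))
      + C (n : ℝ) * X * fpol s := by
  have hne : fpol s ≠ 0 := by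
    intro h
    have := congrArg (eval 0) h
    rw [fpol, eval_gen] at this
    simp at this
  have hne1 : (1 + X : ℝ[X]) ≠ 0 := by
    intro h
    have := congrArg (eval 0) h
    simp at this
  apply Polynomial.eq_of_infinite_eval_eq
  apply Set.Infinite.mono (s := {x | ¬ IsRoot (fpol s * (1 + X)) x})
  · intro x hx
    simp only [Set.mem_ofPred_eq, IsRoot, eval_mul, mul_eq_zero, not_or, eval_add, eval_one, eval_X] at hx
    have := key_eval s x hx.1 hx.2
    simpa [eval_finsetSum] using this
  · have hf : {x | IsRoot (fpol s * (1 + X)) x}.Finite := by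
      exact Polynomial.finite_setOfPred_isRoot (mul_ne_zero hne hne1)
    exact hf.infinite_compl

/-- Lists of `m` swaps. -/
noncomputable def LL (n : ℕ) : ℕ → Finset (List (Equiv.Perm (Fin n)))
  | 0 => {[]}
  | m + 1 => by classical exact (swaps n ×ˢ LL n m).image (fun p => p.1 :: p.2)

lemma mem_LL {n : ℕ} (m : ℕ) (l : List (Equiv.Perm (Fin n))) :
    l ∈ LL n m ↔ l.length = m ∧ ∀ t ∈ l, t.IsSwap := by
  induction m generalizing l with
  | zero =>
    simp only [LL, Finset.mem_singleton, List.length_eq_zero_iff]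
    constructor
    · rintro rfl; simp
    · exact fun h => h.1
  | succ m ih =>
    cases l with
    | nil => simp [LL]
    | cons a l => simp [LL, ih, mem_swaps]; tauto

lemma sum_LL_succ {n : ℕ} {R : Type*} [AddCommMonoid R] (m : ℕ)
    (F : List (Equiv.Perm (Fin n)) → R) :
    ∑ l ∈ LL n (m + 1), F l = ∑ l ∈ LL n m, ∑ t ∈ swaps n, F (t :: l) := by
  classical
  rw [LL, Finset.sum_image, Finset.sum_product_right]
  rintro ⟨a, l⟩ _ ⟨b, l'⟩ _ h
  simpa using h

lemma prodLR_cons {n : ℕ} (t : Equiv.Perm (Fin n)) (l : List (Equiv.Perm (Fin n))) :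
    prodLR (t :: l) = prodLR l * t := by
  simp [prodLR]

open Polynomial in
lemma H_formula (N m : ℕ) :
    ∑ l ∈ LL (N + 1) m, fpol (prodLR l) = (1 + X) * ∑ k ∈ Finset.range (N + 1),
      C ((N.choose k : ℝ) * (((N : ℝ) + 1) * N / 2 - (N + 1) * k) ^ m) * X ^ k := by
  have hne1 : (1 + X : ℝ[X]) ≠ 0 := by
    intro h
    have := congrArg (eval 0) h
    simp at this
  induction m with
  | zero =>
    have h1 : (1 + (X : ℝ[X]) • (Matrix.map (1 : Matrix (Fin (N+1)) (Fin (N+1)) ℝ) C))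
        = (1 + X : ℝ[X]) • 1 := by
      rw [Matrix.map_one _ (map_zero _) (map_one _), add_smul, one_smul]
    simp only [LL, Finset.sum_singleton, prodLR, List.reverse_nil, List.prod_nil, fpol,
      Matrix.permMatrix_one]
    rw [h1, Matrix.det_smul, Matrix.det_one, Fintype.card_fin, mul_one, pow_succ', add_comm 1 X, add_pow]
    congr 1
    refine Finset.sum_congr rfl fun k _ => ?_
    simp [mul_comm]
  | succ m ih =>
    apply mul_left_cancel₀ hne1
    rw [sum_LL_succ, Finset.mul_sum]
    simp only [prodLR_cons]
    rw [Finset.sum_congr rfl fun l _ => key_poly (prodLR l)]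
    rw [Finset.sum_add_distrib, ← Finset.mul_sum, Finset.sum_sub_distrib, ← Finset.mul_sum,
      ← Finset.mul_sum, ← Finset.mul_sum, ← derivative_sum, ih]
    set Q := ∑ k ∈ Finset.range (N + 1),
      C ((N.choose k : ℝ) * (((N : ℝ) + 1) * N / 2 - (N + 1) * k) ^ m) * X ^ k with hQ
    have hQ' : ∑ k ∈ Finset.range (N + 1),
      C ((N.choose k : ℝ) * (((N : ℝ) + 1) * N / 2 - (N + 1) * k) ^ (m + 1)) * X ^ k
       = C (((N : ℝ) + 1) * N / 2) * Q - C ((N : ℝ) + 1) * X * derivative Q := by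
      rw [hQ, derivative_sum, Finset.mul_sum, Finset.mul_sum, ← Finset.sum_sub_distrib]
      refine Finset.sum_congr rfl fun k _ => ?_
      rw [derivative_C_mul_X_pow]
      cases k with
      | zero => simp [pow_succ]; ring
      | succ k =>
        simp only [Nat.add_sub_cancel, pow_succ, map_mul, map_sub, map_add]
        ring
    rw [hQ']
    simp only [derivative_mul, derivative_add, derivative_one, derivative_X, zero_add, one_mul]
    push_cast
    simp only [add_sub_cancel_right]
    ring

open Polynomial Matrix in
lemma fpol_deriv_of_transitive {n : ℕ} (hn : 2 ≤ n) (s : Equiv.Perm (Fin n)) (hs : s.IsCycle)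
    (hsup : s.support = Finset.univ) :
    eval (-1) (derivative (fpol s)) = n := by
  have hmove : ∀ i, s i ≠ i := fun i => by
    have : i ∈ s.support := by simp [hsup]
    simpa using this
  have hf : fpol s = 1 + C (((Equiv.Perm.sign s : ℤ) : ℝ)) * X ^ n := by
    rw [fpol, ← Matrix.det_transpose, Matrix.det_apply]
    have hent : ∀ t : Equiv.Perm (Fin n), ∀ i,
        ((1 + (X : ℝ[X]) • (s.permMatrix ℝ).map C)ᵀ (t i) i) =
          (if t i = i then 1 else 0) + (if t i = s i then X else 0) := by
      intro t i
      simp [Matrix.one_apply, PEquiv.toMatrix_apply, Equiv.toPEquiv_apply, eq_comm]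
    simp only [hent]
    have h1s : (1 : Equiv.Perm (Fin n)) ≠ s := fun h => hs.ne_one h.symm
    rw [← Finset.sum_subset (Finset.subset_univ {1, s}), Finset.sum_pair h1s]
    · have a1 : ∀ i, (if (1 : Equiv.Perm (Fin n)) i = i then (1 : ℝ[X]) else 0)
          + (if (1 : Equiv.Perm (Fin n)) i = s i then X else 0) = 1 := by
        intro i; simp [(hmove i).symm]
      simp only [a1]
      rcases Int.units_eq_one_or (Equiv.Perm.sign s) with h | h <;> simp [h, hmove]
    · intro t _ ht
      simp only [Finset.mem_insert, Finset.mem_singleton, not_or] at ht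
      have : ∃ i, t i ≠ i ∧ t i ≠ s i := by
        by_contra hcon
        push Not at hcon
        apply ht.2
        have hex : ∃ i, t i ≠ i := by
          by_contra h
          push Not at h
          exact ht.1 (Equiv.ext h)
        obtain ⟨i, hi⟩ := hex
        have step : ∀ k : ℕ, t ((s ^ k) i) ≠ (s ^ k) i := by
          intro k
          induction k with
          | zero => simpa using hi
          | succ k ih =>
            intro h
            have e := hcon _ ih
            rw [pow_succ', Equiv.Perm.mul_apply] at h
            rw [← h] at e
            have e' := t.injective e
            exact hmove _ e'.symm
        ext1 j
        apply hcon
        obtain ⟨k, hk⟩ := hs.exists_pow_eq (hmove i) (hmove j)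
        rw [← hk]
        exact step k
      obtain ⟨i, h1, h2⟩ := this
      rw [Finset.prod_eq_zero (Finset.mem_univ i), smul_zero]
      simp [h1, h2]
  rw [hf]
  have hsg := hs.sign
  rw [hsup, Finset.card_univ, Fintype.card_fin] at hsg
  obtain ⟨k, rfl⟩ : ∃ k, n = k + 1 := ⟨n - 1, by omega⟩
  have hc : (((Equiv.Perm.sign s : ℤˣ) : ℤ) : ℝ) = (-1) ^ k := by
    rw [hsg]; simp [pow_succ]
  rw [hc, derivative_add, derivative_C_mul_X_pow, derivative_one, zero_add, eval_mul, eval_C,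
    Nat.add_sub_cancel, eval_pow, eval_X]
  have h1 : ((-1 : ℝ) ^ k) * (-1) ^ k = 1 := by rw [← mul_pow]; simp
  linear_combination ((k + 1 : ℕ) : ℝ) * h1

open Polynomial Matrix in
lemma fpol_deriv_of_not {n : ℕ} (s : Equiv.Perm (Fin n)) (a b : Fin n) (hab : ¬ s.SameCycle a b) :
    eval (-1) (derivative (fpol s)) = 0 := by
  classical
  let p : Fin n → Prop := fun i => s.SameCycle a i
  have hinv : ∀ i, p (s i) ↔ p i := fun i => Equiv.Perm.sameCycle_apply_right
  have hz : ∀ i, ∀ (q : Fin n → Prop) [DecidablePred q], (∀ i, q (s i) ↔ q i) → q i →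
      eval (-1) ((1 + (X : ℝ[X]) • (s.permMatrix ℝ).map C).toSquareBlockProp q).det = 0 := by
    intro i q _ hq hi
    rw [← coe_evalRingHom, RingHom.map_det]
    apply Matrix.exists_mulVec_eq_zero_iff.mp
    refine ⟨fun _ => 1, ?_, ?_⟩
    · intro h
      have := congrFun h ⟨i, hi⟩
      simp at this
    · ext ⟨j, hj⟩
      have hsj : q (s j) := (hq j).mpr hj
      have he : ∀ k : {k // q k}, (((evalRingHom (-1 : ℝ)).mapMatrix
          ((1 + (X : ℝ[X]) • (s.permMatrix ℝ).map C).toSquareBlockProp q)) ⟨j, hj⟩ k)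
            = (if k = ⟨j, hj⟩ then 1 else 0) - (if k = ⟨s j, hsj⟩ then 1 else 0) := by
        rintro ⟨k, hk⟩
        have e1 : k = j ↔ j = k := eq_comm
        have e2 : k = s j ↔ s j = k := eq_comm
        simp only [toSquareBlockProp, RingHom.mapMatrix_apply, Matrix.map_apply, Matrix.of_apply,
          Matrix.add_apply, Matrix.smul_apply, Matrix.one_apply, PEquiv.toMatrix_apply,
          Equiv.toPEquiv_apply, e1, e2, Subtype.mk.injEq, Option.mem_def, Option.some.injEq]
        split_ifs <;> simp <;> rw [Matrix.one_apply] <;> split_ifs <;> simp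
      simp only [Matrix.mulVec, dotProduct, he, mul_one, Finset.sum_sub_distrib]
      simp
  rw [fpol, Matrix.twoBlockTriangular_det _ p]
  · rw [derivative_mul, eval_add, eval_mul, eval_mul, hz a p hinv (Equiv.Perm.SameCycle.refl _ _),
      hz b (fun i => ¬ p i) (fun i => not_congr (hinv i)) hab]
    simp
  · intro i hi j hj
    have h1 : i ≠ j := by rintro rfl; exact hi hj
    have h2 : s i ≠ j := by rintro rfl; exact hi ((hinv i).mp hj)
    simp [h1, h2, PEquiv.toMatrix_apply, Equiv.toPEquiv_apply]

lemma fpol_deriv {n : ℕ} (hn : 2 ≤ n) (s : Equiv.Perm (Fin n)) :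
    Polynomial.eval (-1) (Polynomial.derivative (fpol s))
      = if s.cycleType = {n} then (n : ℝ) else 0 := by
  split_ifs with h
  · have hc : s.IsCycle := by
      rw [← Equiv.Perm.card_cycleType_eq_one, h]; simp
    apply fpol_deriv_of_transitive hn s hc
    apply Finset.eq_univ_of_card
    rw [← Equiv.Perm.sum_cycleType, h]
    simp
  · by_cases hall : ∀ a b, s.SameCycle a b
    · exfalso
      apply h
      haveI : NeZero n := ⟨by omega⟩
      have hmove : ∀ i, s i ≠ i := by
        intro i hi
        obtain ⟨j, hj⟩ : ∃ j : Fin n, j ≠ i := by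
          haveI : Nontrivial (Fin n) := Fin.nontrivial_iff_two_le.mpr hn
          exact exists_ne i
        have := (hall i j).eq_of_left hi
        exact hj this.symm
      have hc : s.IsCycle := ⟨0, hmove 0, fun j _ => hall 0 j⟩
      rw [hc.cycleType]
      have : s.support = Finset.univ := by
        ext i; simpa using hmove i
      simp [this]
    · push Not at hall
      obtain ⟨a, b, hab⟩ := hall
      exact fpol_deriv_of_not s a b hab

lemma card_conj {n : ℕ} (m : ℕ) (s t : Equiv.Perm (Fin n)) (h : IsConj s t) :
    ((LL n m).filter (fun l => prodLR l = s)).card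
      = ((LL n m).filter (fun l => prodLR l = t)).card := by
  obtain ⟨c, hc⟩ := isConj_iff.mp h
  have hmap : ∀ (d : Equiv.Perm (Fin n)) (l : List (Equiv.Perm (Fin n))),
      prodLR (l.map (MulAut.conj d)) = d * prodLR l * d⁻¹ := by
    intro d l
    rw [prodLR, ← List.map_reverse, ← MulAut.conj_apply, prodLR, map_list_prod]
  have hmem : ∀ (d : Equiv.Perm (Fin n)) (l : List (Equiv.Perm (Fin n))), l ∈ LL n m →
      l.map (MulAut.conj d) ∈ LL n m := by
    intro d l hl
    rw [mem_LL] at hl ⊢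
    refine ⟨by simpa using hl.1, ?_⟩
    intro u hu
    rw [List.mem_map] at hu
    obtain ⟨v, hv, rfl⟩ := hu
    obtain ⟨x, y, hxy, rfl⟩ := hl.2 v hv
    refine ⟨d x, d y, d.injective.ne hxy, ?_⟩
    rw [MulAut.conj_apply, Equiv.swap_apply_apply]
  apply Finset.card_nbij' (fun l => l.map (MulAut.conj c)) (fun l => l.map (MulAut.conj c⁻¹))
  · intro l hl
    simp only [Finset.coe_filter, Set.mem_ofPred_eq] at hl ⊢
    exact ⟨hmem c l hl.1, by rw [hmap, hl.2, hc]⟩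
  · intro l hl
    simp only [Finset.coe_filter, Set.mem_ofPred_eq] at hl ⊢
    refine ⟨hmem c⁻¹ l hl.1, ?_⟩
    rw [hmap, hl.2, ← hc]; group
  · intro l _
    simp [Function.comp_def, mul_assoc]
  · intro l _
    simp [Function.comp_def, mul_assoc]

lemma count_formula (N m : ℕ) (hN : 1 ≤ N) :
    ((N + 1).factorial : ℝ) *
      ((LL (N + 1) m).filter (fun l => prodLR l = finRotate (N + 1))).card
      = ∑ k ∈ Finset.range (N + 1),
       ((N.choose k : ℝ) * (((N : ℝ) + 1) * N / 2 - (N + 1) * k) ^ m) * (-1) ^ k := by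
  classical
  have h := congrArg (fun p => Polynomial.eval (-1) (Polynomial.derivative p)) (H_formula N m)
  simp only [Polynomial.derivative_sum, Polynomial.derivative_mul, Polynomial.eval_add,
    Polynomial.eval_mul, Polynomial.derivative_add, Polynomial.derivative_one,
    Polynomial.derivative_X, Polynomial.eval_one, Polynomial.eval_X, zero_add, one_mul,
    Polynomial.eval_zero, Polynomial.eval_finsetSum, Polynomial.eval_C, Polynomial.eval_pow,
    add_neg_cancel, zero_mul, add_zero] at h
  rw [← h]
  have hn : 2 ≤ N + 1 := by omega
  simp only [fpol_deriv hn]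
  rw [← Finset.sum_fiberwise (LL (N + 1) m) (fun l => prodLR l)]
  have hs : ∀ s : Equiv.Perm (Fin (N + 1)),
      ∑ l ∈ (LL (N + 1) m).filter (fun l => prodLR l = s),
        (if (prodLR l).cycleType = {N + 1} then ((N + 1 : ℕ) : ℝ) else 0)
      = if s.cycleType = {N + 1} then ((N + 1 : ℕ) : ℝ) *
        ((LL (N + 1) m).filter (fun l => prodLR l = finRotate (N + 1))).card else 0 := by
    intro s
    rw [Finset.sum_congr rfl (g := fun _ => if s.cycleType = {N + 1} then ((N + 1 : ℕ) : ℝ) else 0)]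
    · rw [Finset.sum_const]
      split_ifs with hc
      · rw [card_conj m s (finRotate (N + 1)), nsmul_eq_mul, mul_comm]
        rw [Equiv.Perm.isConj_iff_cycleType_eq, hc, cycleType_finRotate_of_le hn]
      · simp
    · intro l hl
      rw [(Finset.mem_filter.mp hl).2]
  rw [Finset.sum_congr rfl fun s _ => hs s, ← Finset.sum_filter, Finset.sum_const,
    Equiv.Perm.card_of_cycleType_singleton hn (by simp)]
  simp [Nat.factorial_succ]
  ring

lemma Fcal_ncard (n g : ℕ) : Set.ncard (Fcal n g) =
    ((LL n (n - 1 + 2 * g)).filter (fun l => prodLR l = finRotate n)).card := by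
  rw [← Set.ncard_coe_finset]
  congr 1
  ext l
  simp [Fcal, mem_LL, and_assoc]

open PowerSeries in
/-- The power series `exp (X/2) - exp (-X/2)`. -/
noncomputable def shh : PowerSeries ℝ :=
  rescale (1 / 2 : ℝ) (exp ℝ) - rescale (-1 / 2 : ℝ) (exp ℝ)

open PowerSeries in
/-- The tail of `shh`. -/
noncomputable def RR : PowerSeries ℝ := PowerSeries.mk fun i => coeff (i + 3) shh

open PowerSeries in
lemma coeff_shh (i : ℕ) : coeff i shh = ((1 / 2 : ℝ) ^ i - (-1 / 2) ^ i) * (1 / (i.factorial : ℝ)) := by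
  simp [shh, coeff_exp, coeff_rescale]
  ring

open PowerSeries in
lemma shh_eq : shh = X * (1 + X ^ 2 * RR) := by
  ext i
  rcases i with _ | _ | _ | i
  · rw [coeff_shh]; simp
  · rw [coeff_shh, coeff_succ_X_mul]; simp
    norm_num [pow_two, mul_assoc]
  · rw [coeff_shh, coeff_succ_X_mul]
    rw [map_add, coeff_X_pow_mul', coeff_one]
    norm_num
  · rw [coeff_succ_X_mul, map_add, coeff_X_pow_mul', coeff_one]
    simp [RR]

open PowerSeries in
lemma RR_zero : constantCoeff RR = 1 / 24 := by
  rw [← coeff_zero_eq_constantCoeff_apply, RR, coeff_mk, coeff_shh]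
  norm_num [Nat.factorial]

open PowerSeries in
lemma rescale_exp_pow (c : ℝ) (k : ℕ) :
    (rescale c (exp ℝ)) ^ k = rescale (k * c) (exp ℝ) := by
  rw [← map_pow, exp_pow_eq_rescale_exp, rescale_rescale]

open PowerSeries in
lemma coeff_shh_pow (N m : ℕ) : coeff m (shh ^ N) * (m.factorial : ℝ)
    = ∑ k ∈ Finset.range (N + 1), ((N.choose k : ℝ) * ((N : ℝ) / 2 - k) ^ m) * (-1) ^ k := by
  have h : shh ^ N = ∑ k ∈ Finset.range (N + 1),
      C ((N.choose k : ℝ) * (-1) ^ k) * rescale ((N : ℝ) / 2 - k) (exp ℝ) := by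
    rw [shh, sub_eq_neg_add, add_pow]
    refine Finset.sum_congr rfl fun k hk => ?_
    have hk' : k ≤ N := Nat.lt_succ_iff.mp (Finset.mem_range.mp hk)
    rw [neg_pow, rescale_exp_pow, rescale_exp_pow, mul_assoc, mul_assoc, ← mul_assoc (rescale _ _),
      exp_mul_exp_eq_exp_add, Nat.cast_sub hk', mul_comm (rescale _ _), ← mul_assoc]
    congr 1
    · simp [mul_comm]
    · congr 2
      ring
  rw [h, map_sum, Finset.sum_mul]
  refine Finset.sum_congr rfl fun k _ => ?_
  have hm : (m.factorial : ℝ) ≠ 0 := by positivity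
  rw [coeff_C_mul, coeff_rescale, coeff_exp]
  simp
  field_simp

open PowerSeries in
lemma coeff_shh_pow' (N g : ℕ) : coeff (N + 2 * g) (shh ^ N)
    = ∑ j ∈ Finset.range (g + 1), (N.choose j : ℝ) * coeff (2 * (g - j)) (RR ^ j) := by
  rw [shh_eq, mul_pow, add_comm N, coeff_X_pow_mul, add_comm, add_pow, map_sum]
  have h : ∀ j, coeff (2 * g) ((X ^ 2 * RR) ^ j * 1 ^ (N - j) * (N.choose j : PowerSeries ℝ))
      = if j ≤ g then (N.choose j : ℝ) * coeff (2 * (g - j)) (RR ^ j) else 0 := by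
    intro j
    rw [one_pow, mul_one, mul_pow, ← pow_mul, mul_assoc, coeff_X_pow_mul']
    by_cases hj : j ≤ g
    · rw [if_pos hj, if_pos (by omega), mul_comm (RR ^ j), ← map_natCast (C (R := ℝ)), coeff_C_mul,
        Nat.mul_sub]
    · rw [if_neg hj, if_neg (by omega)]
  simp only [h]
  rw [← Finset.sum_filter, ← Finset.sum_filter_of_ne (s := Finset.range (g + 1)) (p := fun j => j ≤ N)]
  · congr 1
    ext j
    simp
    omega
  · intro j _ hne
    by_contra hc
    apply hne
    rw [Nat.choose_eq_zero_of_lt (by omega)]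
    simp

lemma lim_fact (k : ℕ) : Tendsto (fun N : ℕ =>
    ((N + k).factorial : ℝ) / ((N.factorial : ℝ) * ((N : ℝ) + 1) ^ k)) atTop (nhds 1) := by
  induction k with
  | zero =>
    have : (fun N : ℕ => ((N + 0).factorial : ℝ) / ((N.factorial : ℝ) * ((N : ℝ) + 1) ^ 0))
      = fun _ => 1 := by
      funext N
      have : (N.factorial : ℝ) ≠ 0 := by positivity
      simp [this]
    rw [this]; exact tendsto_const_nhds
  | succ k ih =>
    have h2 : Tendsto (fun N : ℕ => 1 + (k : ℝ) * (1 / ((N : ℝ) + 1))) atTop (nhds (1 + k * 0)) :=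
      (tendsto_one_div_add_atTop_nhds_zero_nat.const_mul _).const_add _
    have h3 := ih.mul h2
    simp only [mul_zero, add_zero, mul_one] at h3
    refine h3.congr fun N => ?_
    have : (N.factorial : ℝ) ≠ 0 := by positivity
    have : (N : ℝ) + 1 ≠ 0 := by positivity
    rw [← add_assoc, Nat.factorial_succ]
    push_cast
    field_simp
    ring

lemma lim_choose (j : ℕ) : Tendsto (fun N : ℕ =>
    (N.choose j : ℝ) / ((N : ℝ) + 1) ^ j) atTop (nhds (1 / (j.factorial : ℝ))) := by
  have hz : ∀ᶠ (x : ℕ) in atTop, ((x : ℝ) ^ j / (j.factorial : ℝ)) ≠ 0 :=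
    eventually_atTop.mpr ⟨1, fun n hn => by
      have : (0 : ℝ) < n := by exact_mod_cast hn
      positivity⟩
  have h1 := (Asymptotics.isEquivalent_iff_tendsto_one hz).mp (isEquivalent_choose j)
  have h2 := ((tendsto_natCast_div_add_atTop (1 : ℝ)).pow j).mul_const (1 / (j.factorial : ℝ))
  have h3 := h1.mul h2
  simp only [one_pow, one_mul] at h3
  refine h3.congr' ?_
  filter_upwards [eventually_ge_atTop 1] with N hN
  have : (0 : ℝ) < N := by exact_mod_cast hN
  have : (j.factorial : ℝ) ≠ 0 := by positivity
  simp only [Pi.div_apply, div_pow]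
  field_simp

lemma lim_sum (g : ℕ) : Tendsto (fun N : ℕ =>
    (∑ j ∈ Finset.range (g + 1), (N.choose j : ℝ) * PowerSeries.coeff (2 * (g - j)) (RR ^ j))
      / ((N : ℝ) + 1) ^ g) atTop (nhds (1 / (24 ^ g * (g.factorial : ℝ)))) := by
  have h0 : Tendsto (fun N : ℕ => ∑ j ∈ Finset.range (g + 1),
      ((N.choose j : ℝ) / ((N : ℝ) + 1) ^ j) * (1 / ((N : ℝ) + 1)) ^ (g - j) *
        PowerSeries.coeff (2 * (g - j)) (RR ^ j)) atTop
      (nhds (∑ j ∈ Finset.range (g + 1), (1 / (j.factorial : ℝ)) * 0 ^ (g - j) *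
        PowerSeries.coeff (2 * (g - j)) (RR ^ j))) := by
    apply tendsto_finsetSum
    intro j _
    exact ((lim_choose j).mul (tendsto_one_div_add_atTop_nhds_zero_nat.pow _)).mul_const _
  have e : (∑ j ∈ Finset.range (g + 1), (1 / (j.factorial : ℝ)) * 0 ^ (g - j) *
        PowerSeries.coeff (2 * (g - j)) (RR ^ j)) = 1 / (24 ^ g * (g.factorial : ℝ)) := by
    rw [Finset.sum_range_succ, Finset.sum_eq_zero]
    · simp [RR_zero]
    · intro j hj
      have : g - j ≠ 0 := by have := Finset.mem_range.mp hj; omega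
      simp [this]
  rw [e] at h0
  refine h0.congr fun N => ?_
  rw [Finset.sum_div]
  refine Finset.sum_congr rfl fun j hj => ?_
  obtain ⟨d, rfl⟩ : ∃ d, g = j + d := ⟨g - j, by have := Finset.mem_range.mp hj; omega⟩
  have : (N : ℝ) + 1 ≠ 0 := by positivity
  rw [Nat.add_sub_cancel_left, one_div_pow, pow_add]
  field_simp

lemma main_count (N g : ℕ) (hN : 1 ≤ N) :
    ((N + 1).factorial : ℝ) * (Set.ncard (Fcal (N + 1) g) : ℝ)
      = ((N : ℝ) + 1) ^ (N + 2 * g) * ((∑ j ∈ Finset.range (g + 1),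
        (N.choose j : ℝ) * PowerSeries.coeff (2 * (g - j)) (RR ^ j)) * ((N + 2 * g).factorial : ℝ)) := by
  rw [Fcal_ncard, Nat.add_sub_cancel, count_formula N _ hN, ← coeff_shh_pow', coeff_shh_pow,
    Finset.mul_sum]
  refine Finset.sum_congr rfl fun k _ => ?_
  have : ((N : ℝ) + 1) * N / 2 - (N + 1) * k = (N + 1) * (N / 2 - k) := by ring
  rw [this, mul_pow]
  ring

theorem stmt11 (g : ℕ) :
    Tendsto (fun n : ℕ =>
        (Set.ncard (Fcal n g) : ℝ) * (24 ^ g * (Nat.factorial g : ℝ)) /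
          (n : ℝ) ^ (n - 2 + 5 * g))
      atTop (nhds 1) := by
  rw [← tendsto_add_atTop_iff_nat 1]
  have h := ((lim_fact (2 * g)).mul (lim_sum g)).mul_const (24 ^ g * (Nat.factorial g : ℝ))
  have e : (1 : ℝ) * (1 / (24 ^ g * (g.factorial : ℝ))) * (24 ^ g * (Nat.factorial g : ℝ)) = 1 := by
    have : (24 ^ g * (Nat.factorial g : ℝ)) ≠ 0 := by positivity
    field_simp
  rw [e] at h
  refine h.congr' ?_
  filter_upwards [eventually_ge_atTop 1] with N hN
  have hc := main_count N g hN
  obtain ⟨M, rfl⟩ : ∃ M, N = M + 1 := ⟨N - 1, by omega⟩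
  set S := ∑ j ∈ Finset.range (g + 1),
    ((M + 1).choose j : ℝ) * PowerSeries.coeff (2 * (g - j)) (RR ^ j)
  set F := (Set.ncard (Fcal (M + 1 + 1) g) : ℝ)
  have e1 : M + 1 + 1 - 2 + 5 * g = M + 5 * g := by omega
  rw [e1]
  rw [Nat.factorial_succ (M + 1)] at hc
  have hy : (((M + 1 : ℕ) : ℝ) + 1) ≠ 0 := by positivity
  have hf : ((M + 1).factorial : ℝ) ≠ 0 := by positivity
  push_cast at hc hy ⊢
  generalize ((M + 1).factorial : ℝ) = f at *
  generalize ((M + 1 + 2 * g).factorial : ℝ) = G at *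
  generalize (M : ℝ) + 1 + 1 = y at *
  have hF : F = y ^ (M + 2 * g) * (S * G) / f := by
    rw [eq_div_iff hf]
    apply mul_left_cancel₀ hy
    rw [← mul_comm f F, ← mul_assoc, hc]
    ring
  rw [hF]
  have e2 : y ^ (M + 5 * g) = y ^ (M + 2 * g) * (y ^ (2 * g) * y ^ g) := by ring
  rw [e2]
  field_simp
end

section
/- For every n ≥ 2, the number of minimal factorizations of the n-cycle into transpositions equals n^{n−2}; that is, |𝔽ₙ⁰| = n^{n−2}. -/
open Equiv Equiv.Perm in
theorem aux_merge {α : Type*} [Fintype α] [DecidableEq α] (σ : Perm α) (x y : α)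
    (h : ¬ σ.SameCycle x y) : (swap x y * σ).SameCycle x y := by
  have h1 : ∀ k : ℕ, (swap x y * σ).SameCycle y ((σ ^ k) y) := by
    intro k
    induction k with
    | zero => exact SameCycle.refl _ _
    | succ k ih =>
      by_cases hy : (σ ^ (k+1)) y = y
      · rw [hy]
      · have hx : (σ ^ (k+1)) y ≠ x := by
          intro hx
          apply h
          exact SameCycle.symm ⟨((k+1 : ℕ) : ℤ), by rw [zpow_natCast]; exact hx⟩
        have : (σ ^ (k+1)) y = (swap x y * σ) ((σ ^ k) y) := by
          have e : (σ ^ (k+1)) y = σ ((σ ^ k) y) := by rw [pow_succ']; rfl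
          rw [e] at hx hy ⊢
          rw [Perm.mul_apply, swap_apply_of_ne_of_ne hx hy]
        rw [this]
        exact SameCycle.trans ih ⟨1, by simp⟩
  have h2 : σ.SameCycle y (σ⁻¹ y) := ⟨-1, by simp⟩
  obtain ⟨k, hk⟩ := h2.exists_nat_pow_eq
  have h3 := h1 k
  rw [hk] at h3
  have : (swap x y * σ).SameCycle (σ⁻¹ y) x := ⟨1, by simp⟩
  exact (h3.trans this).symm

/-- a function constant along a permutation is constant on cycles -/
theorem aux_const {α β : Type*} [Fintype α] [DecidableEq α] (σ : Equiv.Perm α) (f : α → β)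
    (h : ∀ i, f (σ i) = f i) {i j : α} (hij : σ.SameCycle i j) : f i = f j := by
  obtain ⟨k, hk⟩ := hij.exists_nat_pow_eq
  subst hk
  induction k with
  | zero => rfl
  | succ k ih => 
    rw [pow_succ', Equiv.Perm.mul_apply, h]
    exact ih ⟨k, by simp⟩

theorem aux_sub {α : Type*} [Fintype α] [DecidableEq α] (σ τ : Equiv.Perm α)
    (h : ∀ i, τ.SameCycle i (σ i)) {i j : α} (hij : σ.SameCycle i j) : τ.SameCycle i j := by
  obtain ⟨k, hk⟩ := hij.exists_nat_pow_eq
  subst hk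
  induction k with
  | zero => exact Equiv.Perm.SameCycle.refl _ _
  | succ k ih => 
    rw [pow_succ', Equiv.Perm.mul_apply]
    exact (ih ⟨k, by simp⟩).trans (h _)

/-- `ρ` picks one representative in each cycle of `σ`. -/
def GoodRoot {α : Type*} (σ : Equiv.Perm α) (ρ : α → α) : Prop :=
  (∀ i j, σ.SameCycle i j ↔ ρ i = ρ j) ∧ ∀ i, ρ (ρ i) = ρ i

theorem good_exists {α : Type*} (σ : Equiv.Perm α) : ∃ ρ, GoodRoot σ ρ := by
  let s : Setoid α := Equiv.Perm.SameCycle.setoid σ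
  have h0 : ∀ i, σ.SameCycle (Quotient.out (Quotient.mk s i)) i := fun i => Quotient.mk_out (s := s) i
  have h1 : ∀ i j, σ.SameCycle i j ↔ Quotient.out (Quotient.mk s i) = Quotient.out (Quotient.mk s j) := by
    intro i j
    constructor
    · intro h
      have : Quotient.mk s i = Quotient.mk s j := Quotient.sound h
      rw [this]
    · intro h
      exact (h0 i).symm.trans (h ▸ h0 j)
  exact ⟨fun i => Quotient.out (Quotient.mk s i), h1, fun i => (h1 _ _).1 (h0 i)⟩

theorem good_card_le {α : Type*} [Fintype α] [DecidableEq α] {σ τ : Equiv.Perm α} {ρ ρ' : α → α}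
    (h : GoodRoot σ ρ) (h' : GoodRoot τ ρ') (hs : ∀ i j, σ.SameCycle i j → τ.SameCycle i j) :
    (Finset.univ.image ρ').card ≤ (Finset.univ.image ρ).card := by
  calc _ ≤ ((Finset.univ.image ρ).image ρ').card := by
        apply Finset.card_le_card
        intro a ha
        simp only [Finset.mem_image, Finset.mem_univ, true_and] at ha ⊢
        obtain ⟨i, rfl⟩ := ha
        exact ⟨ρ i, ⟨i, rfl⟩, ((h'.1 _ _).1 (hs _ _ ((h.1 _ _).2 (h.2 i))))⟩
    _ ≤ _ := Finset.card_image_le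

/-- the merge of root functions -/
def mergeRoot {α : Type*} [DecidableEq α] (ρ : α → α) (v r : α) : α → α :=
  fun i => if ρ i = r then ρ v else ρ i

open Equiv Equiv.Perm in
theorem good_merge {α : Type*} [Fintype α] [DecidableEq α] {σ : Perm α} {ρ : α → α}
    (h : GoodRoot σ ρ) {v r : α} (hr : ρ r = r) (hv : ρ v ≠ r) :
    GoodRoot (swap v r * σ) (mergeRoot ρ v r) := by
  have hnot : ¬ σ.SameCycle v r := by rw [h.1, hr]; exact hv
  have hm := aux_merge σ v r hnot
  have hstep : ∀ i, ρ (σ i) = ρ i := fun i => (h.1 _ _).1 (SameCycle.symm ⟨1, by simp⟩)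
  have hsub : ∀ i j, σ.SameCycle i j → (swap v r * σ).SameCycle i j := by
    intro i j hij
    refine aux_sub σ _ ?_ hij
    intro i
    have h1 : (swap v r * σ).SameCycle i (swap v r (σ i)) := ⟨1, by simp⟩
    by_cases hx : σ i = v
    · rw [hx, swap_apply_left] at h1
      rw [hx]; exact h1.trans hm.symm
    by_cases hy : σ i = r
    · rw [hy, swap_apply_right] at h1
      rw [hy]; exact h1.trans hm
    rwa [swap_apply_of_ne_of_ne hx hy] at h1
  have hroot : ∀ i, (swap v r * σ).SameCycle i (mergeRoot ρ v r i) := by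
    intro i
    have h1 : (swap v r * σ).SameCycle i (ρ i) := hsub _ _ ((h.1 _ _).2 (h.2 i).symm)
    unfold mergeRoot
    split_ifs with hi
    · rw [hi] at h1
      exact h1.trans (hm.symm.trans (hsub _ _ ((h.1 _ _).2 (h.2 v).symm)))
    · exact h1
  refine ⟨fun i j => ⟨fun hij => ?_, fun hij => ?_⟩, fun i => ?_⟩
  · refine aux_const _ _ ?_ hij
    intro i
    rw [Perm.mul_apply]
    by_cases hx : σ i = v
    · have := hstep i
      rw [hx] at this
      rw [hx, swap_apply_left]
      simp [mergeRoot, hr, ← this]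
    by_cases hy : σ i = r
    · have := hstep i
      rw [hy, hr] at this
      rw [hy, swap_apply_right]
      simp [mergeRoot, ← this]
    rw [swap_apply_of_ne_of_ne hx hy]
    simp [mergeRoot, hstep]
  · have := hroot i
    rw [hij] at this
    exact this.trans (hroot j).symm
  · by_cases hi : ρ i = r
    · simp [mergeRoot, hi, h.2]
    · simp [mergeRoot, hi, h.2]

theorem image_merge {α : Type*} [Fintype α] [DecidableEq α] {ρ : α → α}
    {v r : α} (hr : ρ r = r) (hv : ρ v ≠ r) :
    (Finset.univ.image (mergeRoot ρ v r)).card + 1 = (Finset.univ.image ρ).card := by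
  have : Finset.univ.image (mergeRoot ρ v r) = (Finset.univ.image ρ).erase r := by
    ext a
    simp only [Finset.mem_image, Finset.mem_univ, true_and, Finset.mem_erase]
    constructor
    · rintro ⟨i, rfl⟩
      unfold mergeRoot
      split_ifs with hi
      · exact ⟨hv, v, rfl⟩
      · exact ⟨hi, i, rfl⟩
    · rintro ⟨ha, i, rfl⟩
      exact ⟨i, by simp [mergeRoot, ha]⟩
  rw [this, Finset.card_erase_add_one]
  exact Finset.mem_image.2 ⟨r, Finset.mem_univ _, hr⟩

open Equiv Equiv.Perm in
/-- change of root: in a given cycle, put the root at `r` -/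
theorem good_reroot {α : Type*} [DecidableEq α] {σ : Perm α} {ρ : α → α}
    (h : GoodRoot σ ρ) (r : α) :
    GoodRoot σ (fun i => if ρ i = ρ r then r else ρ i) := by
  refine ⟨fun i j => ?_, fun i => ?_⟩
  · rw [h.1]
    have key : ∀ i, ρ i = r → ρ i = ρ r := fun i hi => by rw [← hi, h.2]
    dsimp only
    split_ifs with h1 h2 h2
    · simp [h1, h2]
    · constructor
      · intro hh; exact absurd (hh ▸ h1) h2
      · intro hh; exact absurd (key j hh.symm) h2
    · constructor
      · intro hh; exact absurd (hh.trans h2) h1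
      · intro hh; exact absurd (key i hh) h1
    · rfl
  · dsimp only
    split_ifs with h1 h2 h2
    · rfl
    · exact absurd rfl h2
    · rw [h.2] at h2; exact absurd h2 h1
    · exact h.2 i

open Equiv Equiv.Perm in
/-- cycles are merged or not -/
theorem sub_of_same {α : Type*} [Fintype α] [DecidableEq α] {σ : Perm α} {x y : α}
    (h : σ.SameCycle x y) (i j : α) (hij : (swap x y * σ).SameCycle i j) : σ.SameCycle i j := by
  refine aux_sub _ σ ?_ hij
  intro i
  have h1 : σ.SameCycle i (σ i) := ⟨1, by simp⟩
  rw [Perm.mul_apply]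
  by_cases hx : σ i = x
  · rw [hx] at h1 ⊢; rw [swap_apply_left]; exact h1.trans h
  by_cases hy : σ i = y
  · rw [hy] at h1 ⊢; rw [swap_apply_right]; exact h1.trans h.symm
  rwa [swap_apply_of_ne_of_ne hx hy]

open Equiv Equiv.Perm in
theorem card_bound {α : Type*} [Fintype α] [DecidableEq α] (l : List (Perm α)) :
    (∀ t ∈ l, t.IsSwap) → ∀ ρ, GoodRoot l.prod ρ →
      Fintype.card α ≤ (Finset.univ.image ρ).card + l.length := by
  induction l with
  | nil =>
    intro _ ρ h
    have hid : Function.Injective ρ := by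
      intro i j hij
      have := (h.1 i j).2 hij
      simpa using this
    rw [Finset.card_image_of_injective _ hid]
    simp
  | cons t l ih =>
    intro hl ρ h
    obtain ⟨ρ₀, h₀⟩ := good_exists l.prod
    have hb := ih (fun t ht => hl t (List.mem_cons_of_mem _ ht)) ρ₀ h₀
    obtain ⟨x, y, hxy, rfl⟩ := hl t List.mem_cons_self
    rw [List.prod_cons] at h
    rw [List.length_cons]
    by_cases hs : l.prod.SameCycle x y
    · have := good_card_le h h₀ (sub_of_same hs)
      omega
    · have h1 := good_reroot h₀ y
      have hne : ρ₀ x ≠ ρ₀ y := fun hh => hs ((h₀.1 _ _).2 hh)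
      have hr : (fun i => if ρ₀ i = ρ₀ y then y else ρ₀ i) y = y := by simp
      have hv : (fun i => if ρ₀ i = ρ₀ y then y else ρ₀ i) x ≠ y := by
        simp only [hne, if_false]
        intro hh; apply hne; rw [← hh, h₀.2]
      have h2 := good_merge h1 hr hv
      have h3 := image_merge (ρ := fun i => if ρ₀ i = ρ₀ y then y else ρ₀ i) hr hv
      have h4 := good_card_le h h2 (fun _ _ hh => hh)
      have h5 := good_card_le h1 h₀ (fun _ _ hh => hh)
      omega

/-- factorization histories of length `L` with roots -/
def HistP {α : Type*} [Fintype α] [DecidableEq α] (L : ℕ)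
    (p : List (Equiv.Perm α) × (α → α)) : Prop :=
  p.1.length = L ∧ (∀ t ∈ p.1, t.IsSwap) ∧ GoodRoot p.1.prod p.2 ∧
    (Finset.univ.image p.2).card + L = Fintype.card α

open Equiv Equiv.Perm in
theorem merge_inj {α : Type*} [Fintype α] [DecidableEq α] {σ : Perm α} {ρ ρ' : α → α}
    (h : GoodRoot σ ρ) (h' : GoodRoot σ ρ') {v r v' r' : α} (hr : ρ r = r) (hv : ρ v ≠ r)
    (hr' : ρ' r' = r') (hv' : ρ' v' ≠ r') (hs : swap v r = swap v' r')
    (hm : mergeRoot ρ v r = mergeRoot ρ' v' r') : ρ = ρ' ∧ v = v' ∧ r = r' := by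
  have hvr : v ≠ r := by rintro rfl; exact hv hr
  have e1 : swap v' r' v = r := by rw [← hs, swap_apply_left]
  have hc : (v = v' ∧ r = r') ∨ (v = r' ∧ r = v') := by
    by_cases a : v = v'
    · subst a; rw [swap_apply_left] at e1; exact Or.inl ⟨rfl, e1.symm⟩
    by_cases b : v = r'
    · subst b; rw [swap_apply_right] at e1; exact Or.inr ⟨rfl, e1.symm⟩
    rw [swap_apply_of_ne_of_ne a b] at e1
    exact absurd e1 hvr
  rcases hc with ⟨rfl, rfl⟩ | ⟨rfl, rfl⟩
  · refine ⟨?_, rfl, rfl⟩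
    funext i
    have := congrFun hm i
    have e : ρ i = r ↔ ρ' i = r := by
      have := h.1 i r
      rw [h'.1, hr, hr'] at this
      exact this.symm
    by_cases hi : ρ i = r
    · rw [hi, e.1 hi]
    · have hi' := fun q => hi (e.2 q)
      simp only [mergeRoot] at this
      rwa [if_neg hi, if_neg hi'] at this
  · exfalso
    have := congrFun hm v
    simp only [mergeRoot, hv, hr', if_false, if_true] at this
    have a1 : σ.SameCycle v (ρ v) := (h.1 _ _).2 (h.2 v).symm
    have a2 : σ.SameCycle r (ρ' r) := (h'.1 _ _).2 (h'.2 r).symm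
    rw [this] at a1
    have := (h.1 _ _).1 (a1.trans a2.symm)
    exact hv (this.trans hr)

open Equiv Equiv.Perm in
theorem merge_surj {α : Type*} [Fintype α] [DecidableEq α] {σ : Perm α} {ρ' : α → α} {x y : α}
    (hs : ¬ σ.SameCycle x y) (h : GoodRoot (swap x y * σ) ρ') (hx : σ.SameCycle x (ρ' x)) :
    ∃ ρ, GoodRoot σ ρ ∧ ρ y = y ∧ ρ x ≠ y ∧ mergeRoot ρ x y = ρ' := by
  obtain ⟨ρ₀, h₀⟩ := good_exists σ
  -- a first root function with root y
  have h1 := good_reroot h₀ y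
  set ρ₁ := (fun i => if ρ₀ i = ρ₀ y then y else ρ₀ i) with hρ₁
  have hr : ρ₁ y = y := by simp [hρ₁]
  have hv : ρ₁ x ≠ y := by
    intro hh; exact hs ((h1.1 _ _).2 (hh.trans hr.symm))
  have h2 := good_merge h1 hr hv
  -- `ρ' i` is σ-equivalent to `mergeRoot ρ₁ x y i`
  have h3 : ∀ i, mergeRoot ρ₁ x y i = mergeRoot ρ₁ x y (ρ' i) := fun i =>
    (h2.1 _ _).1 ((h.1 _ _).2 (h.2 i).symm)
  have hxx : ρ₁ (ρ' x) = ρ₁ x := ((h1.1 _ _).1 hx).symm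
  have hmxy : ρ' x = ρ' y := (h.1 _ _).1 (aux_merge σ x y hs)
  have hsame : ∀ i, ρ₁ i = y → ρ' i = ρ' x := by
    intro i hi
    apply (h.1 _ _).1
    rw [h2.1]
    simp [mergeRoot, hi]
  have hk : ∀ i, ρ₁ i ≠ y → ρ₁ (ρ' i) = ρ₁ i := by
    intro i hi
    have := h3 i
    simp only [mergeRoot, hi, if_false] at this
    split_ifs at this with hq
    · have e : ρ' i = ρ' x := by
        apply (h.1 _ _).1
        rw [h2.1]
        simp [mergeRoot, hi, this]
      rw [e, hxx]; exact this.symm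
    · exact this.symm
  have hsub : ∀ i j, ρ₁ i = ρ₁ j → ρ' i = ρ' j := by
    intro i j hij
    apply (h.1 _ _).1
    rw [h2.1]
    simp [mergeRoot, hij]
  refine ⟨fun i => if ρ₁ i = y then y else ρ' i, ⟨?_, ?_⟩, ?_, ?_, ?_⟩
  · intro i j
    rw [h1.1]
    dsimp only
    split_ifs with a b b
    · simp [a, b]
    · constructor
      · intro hh; exact absurd (hh ▸ a) b
      · intro hh; have := hk j b; rw [← hh, hr] at this; exact absurd this.symm b
    · constructor
      · intro hh; exact absurd (hh.trans b) a
      · intro hh; have := hk i a; rw [hh, hr] at this; exact absurd this.symm a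
    · constructor
      · exact hsub i j
      · intro hh; rw [← hk i a, ← hk j b, hh]
  · intro i
    dsimp only
    by_cases a : ρ₁ i = y
    · simp [a, hr]
    · have : ρ₁ (ρ' i) ≠ y := by rw [hk i a]; exact a
      simp [a, this, h.2]
  · simp [hr]
  · simp only [hv, if_false]
    intro hh; rw [hh] at hx; exact hs hx
  · funext i
    have hne : ∀ i, ρ₁ i ≠ y → ρ' i ≠ y := by
      intro i a hh
      have := hk i a
      rw [hh, hr] at this; exact a this.symm
    unfold mergeRoot
    by_cases a : ρ₁ i = y
    · simp [a, hv, hsame i a]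
    · simp [a, hne i a]

open Equiv Equiv.Perm in
theorem hist_count {α : Type*} [Fintype α] [DecidableEq α] (L : ℕ) (hL : L < Fintype.card α) :
    ∃ S : Finset (List (Perm α) × (α → α)), (∀ p, p ∈ S ↔ HistP L p) ∧
      S.card = ∏ k ∈ Finset.range L, (Fintype.card α * (Fintype.card α - 1 - k)) := by
  induction L with
  | zero =>
    refine ⟨{([], id)}, ?_, by simp⟩
    rintro ⟨l, ρ⟩
    simp only [Finset.mem_singleton, Prod.mk.injEq, HistP]
    constructor
    · rintro ⟨rfl, rfl⟩
      refine ⟨rfl, by simp, ⟨by simp, by simp⟩, by simp⟩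
    · rintro ⟨h1, -, h3, -⟩
      have := List.eq_nil_of_length_eq_zero h1
      subst this
      refine ⟨rfl, ?_⟩
      funext i
      have := (h3.1 (ρ i) i).2 (h3.2 i)
      simpa using this
  | succ L ih =>
    obtain ⟨S, hS, hc⟩ := ih (by omega)
    let T : Finset (Σ _ : List (Perm α) × (α → α), Σ _ : α, α) :=
      S.sigma fun p => Finset.univ.sigma fun v => (Finset.univ.image p.2).erase (p.2 v)
    let f : (Σ _ : List (Perm α) × (α → α), Σ _ : α, α) → List (Perm α) × (α → α) :=
      fun q => (swap q.2.1 q.2.2 :: q.1.1, mergeRoot q.1.2 q.2.1 q.2.2)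
    have hT : ∀ l ρ v r, (⟨(l, ρ), ⟨v, r⟩⟩ : Σ _ : List (Perm α) × (α → α), Σ _ : α, α) ∈ T ↔
        HistP L (l, ρ) ∧ ρ r = r ∧ ρ v ≠ r := by
      intro l ρ v r
      simp only [T, Finset.mem_sigma, Finset.mem_univ, true_and, Finset.mem_erase, hS,
        Finset.mem_image]
      constructor
      · rintro ⟨h, h2, i, rfl⟩
        exact ⟨h, h.2.2.1.2 i, h2.symm⟩
      · rintro ⟨h, h2, h3⟩
        exact ⟨h, h3.symm, r, h2⟩
    refine ⟨T.image f, ?_, ?_⟩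
    · rintro ⟨l', ρ'⟩
      rw [Finset.mem_image]
      constructor
      · rintro ⟨⟨⟨l, ρ⟩, ⟨v, r⟩⟩, hq, he⟩
        rw [hT] at hq
        obtain ⟨⟨h1, h2, h3, h4⟩, hr, hv⟩ := hq
        simp only [f, Prod.mk.injEq] at he
        obtain ⟨rfl, rfl⟩ := he
        refine ⟨by simpa using h1, ?_, ?_, ?_⟩
        · intro t ht
          rcases List.mem_cons.1 ht with rfl | ht
          · exact ⟨v, r, by rintro rfl; exact hv hr, rfl⟩
          · exact h2 t ht
        · rw [List.prod_cons]
          exact good_merge h3 hr hv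
        · have := image_merge hr hv
          have h4' : (Finset.univ.image ρ).card + L = Fintype.card α := h4
          dsimp only
          omega
      · rintro ⟨h1, h2, h3, h4⟩
        dsimp only at h1 h2 h3 h4
        cases l' with
        | nil => simp at h1
        | cons t l =>
          have hl : ∀ t ∈ l, t.IsSwap := fun t ht => h2 t (List.mem_cons_of_mem _ ht)
          have hlen : l.length = L := by simpa using h1
          rw [List.prod_cons] at h3
          obtain ⟨x, y, hxy, rfl⟩ := h2 t List.mem_cons_self
          have hs : ¬ l.prod.SameCycle x y := by
            intro hs
            obtain ⟨ρ₀, h₀⟩ := good_exists l.prod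
            have hb := card_bound l hl ρ₀ h₀
            have := good_card_le h3 h₀ (sub_of_same hs)
            omega
          have main : ∀ x y : α, ¬ l.prod.SameCycle x y → GoodRoot (swap x y * l.prod) ρ' →
              l.prod.SameCycle x (ρ' x) → ∃ a ∈ T, f a = (swap x y :: l, ρ') := by
            intro x y hs h3 hx
            obtain ⟨ρ, g1, g2, g3, g4⟩ := merge_surj hs h3 hx
            refine ⟨⟨(l, ρ), ⟨x, y⟩⟩, (hT _ _ _ _).2 ⟨⟨hlen, hl, g1, ?_⟩, g2, g3⟩, by simp [f, g4]⟩
            have := image_merge g2 g3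
            rw [g4] at this
            dsimp only
            omega
          by_cases hx : l.prod.SameCycle x (ρ' x)
          · exact main x y hs h3 hx
          · have hyx : l.prod.SameCycle y (ρ' y) := by
              obtain ⟨ρ₀, h₀⟩ := good_exists l.prod
              have g := good_reroot h₀ y
              set ρ₁ := (fun i => if ρ₀ i = ρ₀ y then y else ρ₀ i) with hρ₁
              have hr : ρ₁ y = y := by simp [hρ₁]
              have hv : ρ₁ x ≠ y := by
                intro hh; exact hs ((g.1 _ _).2 (hh.trans hr.symm))
              have g2 := good_merge g hr hv
              have e := (g2.1 _ _).1 ((h3.1 _ _).2 (h3.2 x).symm)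
              have hmxy : ρ' x = ρ' y := (h3.1 _ _).1 (aux_merge _ x y hs)
              simp only [mergeRoot, hv, if_false] at e
              rw [← hmxy, g.1, hr]
              by_contra hne
              rw [if_neg (fun q => hne q.symm)] at e
              exact hx ((g.1 _ _).2 e)
            rw [swap_comm] at h3 ⊢
            exact main y x (fun q => hs q.symm) h3 hyx
    · rw [Finset.card_image_of_injOn, Finset.prod_range_succ, ← hc, Finset.card_sigma]
      · rw [Finset.sum_const_nat (m := Fintype.card α * (Fintype.card α - 1 - L))]
        intro p hp
        rw [Finset.card_sigma, Finset.sum_const_nat (m := Fintype.card α - 1 - L)]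
        · rw [Finset.card_univ]
        · intro v _
          rw [Finset.card_erase_of_mem (Finset.mem_image_of_mem _ (Finset.mem_univ _))]
          have := ((hS p).1 hp).2.2.2
          omega
      · rintro ⟨⟨l, ρ⟩, ⟨v, r⟩⟩ hq ⟨⟨l', ρ'⟩, ⟨v', r'⟩⟩ hq' he
        rw [Finset.mem_coe, hT] at hq hq'
        simp only [f, Prod.mk.injEq, List.cons.injEq] at he
        obtain ⟨⟨e1, rfl⟩, e2⟩ := he
        obtain ⟨rfl, rfl, rfl⟩ := merge_inj hq.1.2.2.1 hq'.1.2.2.1 hq.2.1 hq.2.2 hq'.2.1 hq'.2.2 e1 e2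
        rfl

open Equiv Equiv.Perm in
theorem cyc_iff {n : ℕ} (hn : 2 ≤ n) (σ : Perm (Fin n)) :
    σ.cycleType = {n} ↔ ∀ i j, σ.SameCycle i j := by
  constructor
  · intro h i j
    have hc : σ.IsCycle := by rw [← card_cycleType_eq_one, h]; simp
    have hs : σ.support.card = n := by rw [← sum_cycleType, h]; simp
    have hu : σ.support = Finset.univ := by
      rw [← Finset.card_eq_iff_eq_univ, hs, Fintype.card_fin]
    have hm : ∀ i, σ i ≠ i := fun i => by rw [← mem_support, hu]; exact Finset.mem_univ _
    exact hc.sameCycle (hm i) (hm j)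
  · intro h
    have hm : ∀ i, σ i ≠ i := by
      intro i hi
      have h1 := (h i ⟨0, by omega⟩).eq_of_left hi
      have h2 := (h i ⟨1, by omega⟩).eq_of_left hi
      have := h1.symm.trans h2
      simp at this
    have hc : σ.IsCycle := ⟨⟨0, by omega⟩, hm _, fun y _ => h _ y⟩
    have hu : σ.support = Finset.univ := by
      ext i; simp [hm i]
    rw [hc.cycleType, hu]; simp

open Equiv Equiv.Perm in
theorem hist_last {n : ℕ} (hn : 2 ≤ n) (l : List (Perm (Fin n))) (ρ : Fin n → Fin n) :
    HistP (n-1) (l, ρ) ↔ l.length = n - 1 ∧ (∀ t ∈ l, t.IsSwap) ∧ l.prod.cycleType = {n} ∧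
      ∃ a, ρ = fun _ => a := by
  unfold HistP
  rw [cyc_iff hn, Fintype.card_fin]
  dsimp only
  refine and_congr_right fun _ => and_congr_right fun _ => ?_
  constructor
  · rintro ⟨h, hc⟩
    have h1 : (Finset.univ.image ρ).card = 1 := by omega
    obtain ⟨a, ha⟩ := Finset.card_eq_one.1 h1
    have hρ : ∀ i, ρ i = a := by
      intro i
      have := Finset.mem_image_of_mem ρ (Finset.mem_univ i)
      rw [ha] at this
      simpa using this
    exact ⟨fun i j => (h.1 i j).2 (by rw [hρ, hρ]), a, funext hρ⟩
  · rintro ⟨h, a, rfl⟩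
    refine ⟨⟨fun i j => by simp [h i j], fun _ => rfl⟩, ?_⟩
    have : (Finset.univ.image fun _ : Fin n => a) = {a} :=
      Finset.image_const ⟨a, Finset.mem_univ _⟩ a
    rw [this, Finset.card_singleton]
    omega

open Equiv Equiv.Perm in
theorem conj_isSwap {n : ℕ} (c t : Perm (Fin n)) (h : t.IsSwap) : (MulAut.conj c t).IsSwap := by
  obtain ⟨x, y, hxy, rfl⟩ := h
  refine ⟨c x, c y, fun q => hxy (c.injective q), ?_⟩
  rw [MulAut.conj_apply, Equiv.mul_swap_eq_swap_mul, mul_assoc, mul_inv_cancel, mul_one]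

theorem stmt12 (n : ℕ) (hn : 2 ≤ n) : Set.ncard (Fcal n 0) = n ^ (n - 2) := by
  classical
  obtain ⟨S, hS, hc⟩ := hist_count (α := Fin n) (n-1) (by simp; omega)
  have hfin : {l : List (Equiv.Perm (Fin n)) | l.length = n - 1 ∧ (∀ t ∈ l, t.IsSwap) ∧
      l.prod = finRotate n}.Finite :=
    (List.finite_length_eq (Equiv.Perm (Fin n)) (n-1)).subset fun l hl => hl.1
  obtain ⟨G, hG⟩ := hfin.exists_finset
  simp only [Set.mem_setOf_eq] at hG
  have hF : Fcal n 0 = List.reverse '' (G : Set (List (Equiv.Perm (Fin n)))) := by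
    ext l
    simp only [Fcal, prodLR, Set.mem_setOf_eq, Set.mem_image, Finset.mem_coe, hG]
    constructor
    · rintro ⟨h1, h2, h3⟩
      exact ⟨l.reverse, ⟨by simpa using h1, by simpa using h2, h3⟩, by simp⟩
    · rintro ⟨l', ⟨h1, h2, h3⟩, rfl⟩
      exact ⟨by simpa using h1, by simpa using h2, by simpa using h3⟩
  rw [hF, Set.ncard_image_of_injective _ List.reverse_injective, Set.ncard_coe_finset]
  let C : Finset (Equiv.Perm (Fin n)) := {g | g.cycleType = {n}}
  have hC : C.card = (n-1).factorial := by
    have := Equiv.Perm.card_of_cycleType_singleton (α := Fin n) hn (by simp)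
    simpa [C] using this
  let z : Fin n := ⟨0, by omega⟩
  have hfib : S.card = (C ×ˢ (Finset.univ : Finset (Fin n))).card * G.card := by
    rw [Finset.card_eq_sum_card_fiberwise (f := fun p => (p.1.prod, p.2 z))
      (t := C ×ˢ (Finset.univ : Finset (Fin n)))]
    · rw [Finset.sum_const_nat (m := G.card)]
      rintro ⟨σ, a⟩ hσ
      have hσ' : σ.cycleType = {n} := by simpa [C] using hσ
      have hconj : IsConj (finRotate n) σ := by
        rw [Equiv.Perm.isConj_iff_cycleType_eq, hσ', cycleType_finRotate_of_le hn]
      obtain ⟨c, hcc⟩ := isConj_iff.1 hconj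
      have himg : S.filter (fun p => (p.1.prod, p.2 z) = (σ, a)) =
          G.image (fun l => (l.map (MulAut.conj c), fun _ => a)) := by
        ext ⟨l, ρ⟩
        simp only [Finset.mem_filter, hS, hist_last hn, Finset.mem_image, hG, Prod.mk.injEq]
        constructor
        · rintro ⟨⟨h1, h2, h3, b, rfl⟩, h5, h6⟩
          refine ⟨l.map (MulAut.conj c⁻¹), ⟨by simpa using h1, ?_, ?_⟩, ?_, ?_⟩
          · intro t ht
            obtain ⟨u, hu, rfl⟩ := List.mem_map.1 ht
            exact conj_isSwap _ _ (h2 u hu)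
          · rw [← map_list_prod, h5, ← hcc]
            simp [mul_assoc]
          · rw [List.map_map]
            conv_rhs => rw [← List.map_id l]
            apply List.map_congr_left
            intro t _
            simp [mul_assoc]
          · rw [← h6]
        · rintro ⟨l', ⟨h1, h2, h3⟩, rfl, rfl⟩
          have hp : (l'.map (MulAut.conj c)).prod = σ := by
            rw [← map_list_prod, h3, ← hcc, MulAut.conj_apply]
          refine ⟨⟨by simpa using h1, ?_, by rw [hp, hσ'], a, rfl⟩, hp, rfl⟩
          intro t ht
          obtain ⟨u, hu, rfl⟩ := List.mem_map.1 ht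
          exact conj_isSwap _ _ (h2 u hu)
      rw [himg, Finset.card_image_of_injective]
      intro l l' h
      simp only [Prod.mk.injEq, and_true] at h
      exact List.map_injective_iff.2 (MulAut.conj c).injective h
    · rintro ⟨l, ρ⟩ hp
      have := (hist_last hn l ρ).1 ((hS _).1 hp)
      simp [C, this.2.2.1]
  rw [hc, Finset.card_product, hC, Finset.card_univ, Fintype.card_fin, Finset.prod_mul_distrib,
    Finset.prod_const, Finset.card_range] at hfib
  have hfac : ∏ k ∈ Finset.range (n-1), (n - 1 - k) = (n-1).factorial := by
    rw [← Nat.descFactorial_eq_prod_range, Nat.descFactorial_self]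
  rw [hfac] at hfib
  obtain ⟨m, rfl⟩ : ∃ m, n = m + 2 := ⟨n - 2, by omega⟩
  have hpos : 0 < (m+2-1).factorial * (m+2) := Nat.mul_pos (Nat.factorial_pos _) (by omega)
  apply Nat.eq_of_mul_eq_mul_left hpos
  rw [← hfib]
  have : m + 2 - 1 = m + 1 := rfl
  rw [this, Nat.add_sub_cancel]
  ring
end
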